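/- For the channel Y = ρ·X + Z, where ρ > 0, Z is a standard normal random variable independent of X, and E[X²] < ∞, the mutual information I(X;Y) as a function of ρ satisfies d/dρ I(X;Y) = ρ·E[(X − E[X|Y])²]. -/

import Mathlib

open MeasureTheory ProbabilityTheory Real

/-- The mutual information `I(X; Y)` between two random variables, defined as the
expectation of the log of the Radon–Nikodym derivative of the joint law with respect to
the product of the marginal laws. -/
noncomputable def mutualInfo {Ω α β : Type*} [MeasurableSpace Ω] [MeasurableSpace α]
    [MeasurableSpace β] (P : Measure Ω) (X : Ω → α) (Y : Ω → β) : ℝ :=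
  ∫ ω, Real.log ((Measure.rnDeriv (P.map (fun ω => (X ω, Y ω)))
      ((P.map X).prod (P.map Y)) (X ω, Y ω)).toReal) ∂P

/-- The unnormalised Gaussian kernel with inverse standard deviation `r`. -/
noncomputable def gaussKer (r u : ℝ) : ℝ := exp (-(r ^ 2 * u ^ 2) / 2)

/-- The `n`-th moment of `t - x` under `x ∼ μ`, weighted by the Gaussian kernel. -/
noncomputable def gaussMoment (μ : Measure ℝ) (n : ℕ) (r t : ℝ) : ℝ :=
  ∫ x, (t - x) ^ n * gaussKer r (t - x) ∂μ

lemma gaussKer_pos (r u : ℝ) : 0 < gaussKer r u := exp_pos _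

lemma gaussKer_le_one (r u : ℝ) : gaussKer r u ≤ 1 := by
  unfold gaussKer
  rw [exp_le_one_iff]
  have : 0 ≤ r ^ 2 * u ^ 2 := by positivity
  linarith

lemma gaussKer_anti {a r : ℝ} (ha : 0 ≤ a) (har : a ≤ r) (u : ℝ) :
    gaussKer r u ≤ gaussKer a u := by
  unfold gaussKer
  rw [exp_le_exp]
  have : a ^ 2 * u ^ 2 ≤ r ^ 2 * u ^ 2 := by gcongr
  linarith

@[fun_prop]
lemma continuous_gaussKer (r : ℝ) : Continuous (gaussKer r) := by
  unfold gaussKer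
  fun_prop

lemma log_gaussKer (r u : ℝ) : log (gaussKer r u) = -(r ^ 2 * u ^ 2) / 2 := log_exp _

lemma hasDerivAt_gaussKer_scale (r u : ℝ) :
    HasDerivAt (fun s => gaussKer s u) (-(r * u ^ 2) * gaussKer r u) r := by
  have h : HasDerivAt (fun s : ℝ => -(s ^ 2 * u ^ 2) / 2) (-(r * u ^ 2)) r := by
    refine ((((hasDerivAt_id' r).fun_pow 2).mul_const (u ^ 2)).fun_neg.div_const 2).congr_deriv ?_
    norm_num
    ring
  exact h.exp.congr_deriv (mul_comm _ _)

lemma hasDerivAt_gaussKer (r u : ℝ) :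
    HasDerivAt (gaussKer r) (-(r ^ 2 * u) * gaussKer r u) u := by
  have h : HasDerivAt (fun s : ℝ => -(r ^ 2 * s ^ 2) / 2) (-(r ^ 2 * u)) u := by
    refine ((((hasDerivAt_id' u).fun_pow 2).const_mul (r ^ 2)).fun_neg.div_const 2).congr_deriv ?_
    norm_num
    ring
  exact h.exp.congr_deriv (mul_comm _ _)

lemma exists_abs_pow_mul_gaussKer_le {r : ℝ} (hr : 0 < r) (n : ℕ) :
    ∃ C, ∀ u, |u| ^ n * gaussKer r u ≤ C := by
  refine ⟨1 + n.factorial * (2 / r ^ 2) ^ n, fun u => ?_⟩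
  have h1 : |u| ^ n ≤ 1 + (u ^ 2) ^ n := by
    rw [← sq_abs, ← pow_mul, mul_comm 2 n, pow_mul]
    nlinarith [sq_nonneg (|u| ^ n - 1)]
  have h2 : (u ^ 2) ^ n * gaussKer r u ≤ n.factorial * (2 / r ^ 2) ^ n := by
    have h := pow_div_factorial_le_exp (x := r ^ 2 * u ^ 2 / 2) (by positivity) n
    rw [div_le_iff₀ (by positivity)] at h
    have e : (u ^ 2) ^ n = (2 / r ^ 2) ^ n * (r ^ 2 * u ^ 2 / 2) ^ n := by
      rw [← mul_pow]
      congr 1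
      field_simp
    calc (u ^ 2) ^ n * gaussKer r u
        ≤ (2 / r ^ 2) ^ n * (exp (r ^ 2 * u ^ 2 / 2) * n.factorial) * gaussKer r u := by
          rw [e]
          gcongr
          exact (gaussKer_pos _ _).le
      _ = n.factorial * (2 / r ^ 2) ^ n * (exp (r ^ 2 * u ^ 2 / 2) * gaussKer r u) := by ring
      _ = n.factorial * (2 / r ^ 2) ^ n := by
          rw [gaussKer, ← exp_add]
          ring_nf
          simp
  nlinarith [gaussKer_le_one r u, gaussKer_pos r u]

section Moments

variable {μ : Measure ℝ} [IsProbabilityMeasure μ]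

lemma integrable_pow_mul_gaussKer {r : ℝ} (hr : 0 < r) (n : ℕ) (t : ℝ) :
    Integrable (fun x => (t - x) ^ n * gaussKer r (t - x)) μ := by
  obtain ⟨C, hC⟩ := exists_abs_pow_mul_gaussKer_le hr n
  refine Integrable.of_bound (by fun_prop) C (ae_of_all _ fun x => ?_)
  rw [norm_mul, norm_pow, norm_eq_abs, norm_of_nonneg (gaussKer_pos _ _).le]
  exact hC _

lemma measurable_gaussMoment (n : ℕ) (r : ℝ) : Measurable (gaussMoment μ n r) := by
  unfold gaussMoment
  refine (StronglyMeasurable.integral_prod_right (ν := μ)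
    (f := fun t x : ℝ => (t - x) ^ n * gaussKer r (t - x)) ?_).measurable
  exact Continuous.stronglyMeasurable (by fun_prop)

lemma gaussMoment_zero_pos {r : ℝ} (hr : 0 < r) (t : ℝ) : 0 < gaussMoment μ 0 r t := by
  unfold gaussMoment
  have h := integrable_pow_mul_gaussKer (μ := μ) hr 0 t
  simp only [pow_zero, one_mul] at h ⊢
  rw [integral_pos_iff_support_of_nonneg (fun x => (gaussKer_pos _ _).le) h]
  have : Function.support (fun x => gaussKer r (t - x)) = Set.univ := by
    ext x
    simp [(gaussKer_pos r (t - x)).ne']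
  simp [this]

lemma gaussMoment_zero_le_one {r : ℝ} (hr : 0 < r) (t : ℝ) : gaussMoment μ 0 r t ≤ 1 := by
  unfold gaussMoment
  calc _ ≤ ∫ _, (1 : ℝ) ∂μ := by
        refine integral_mono (integrable_pow_mul_gaussKer hr 0 t) (integrable_const _) fun x => ?_
        simpa using gaussKer_le_one r (t - x)
    _ = 1 := by simp

lemma hasDerivAt_gaussMoment_scale (n : ℕ) {r : ℝ} (hr : 0 < r) (t : ℝ) :
    HasDerivAt (fun s => gaussMoment μ n s t) (-r * gaussMoment μ (n + 2) r t) r := by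
  obtain ⟨C, hC⟩ := exists_abs_pow_mul_gaussKer_le (half_pos hr) (n + 2)
  have h := (hasDerivAt_integral_of_dominated_loc_of_deriv_le (μ := μ) (𝕜 := ℝ)
    (F := fun s x => (t - x) ^ n * gaussKer s (t - x))
    (F' := fun s x => (t - x) ^ n * (-(s * (t - x) ^ 2) * gaussKer s (t - x)))
    (s := Set.Ioo (r / 2) (2 * r)) (x₀ := r) (bound := fun _ => 2 * r * C)
    (Ioo_mem_nhds (by linarith) (by linarith))
    (Filter.Eventually.of_forall fun s => by fun_prop)
    (integrable_pow_mul_gaussKer hr n t) (by fun_prop)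
    (ae_of_all _ fun x s hs => ?_) (integrable_const _)
    (ae_of_all _ fun x s hs => (hasDerivAt_gaussKer_scale s (t - x)).const_mul _)).2
  · refine h.congr_deriv ?_
    unfold gaussMoment
    rw [← integral_const_mul]
    congr with x
    ring
  · have hs0 : 0 < s := by linarith [hs.1]
    have e : ‖(t - x) ^ n * (-(s * (t - x) ^ 2) * gaussKer s (t - x))‖
        = s * (|t - x| ^ (n + 2) * gaussKer s (t - x)) := by
      simp only [norm_mul, norm_neg, norm_pow, norm_eq_abs, abs_of_pos hs0,
        abs_of_pos (gaussKer_pos _ _)]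
      ring
    rw [e]
    have h1 := hC (t - x)
    have h2 := gaussKer_anti (half_pos hr).le hs.1.le (t - x)
    have hC0 : 0 ≤ |t - x| ^ (n + 2) * gaussKer s (t - x) :=
      mul_nonneg (by positivity) (gaussKer_pos _ _).le
    have h3 : |t - x| ^ (n + 2) * gaussKer s (t - x) ≤ C :=
      (mul_le_mul_of_nonneg_left h2 (by positivity)).trans h1
    exact mul_le_mul hs.2.le h3 hC0 (by linarith)

lemma hasDerivAt_gaussMoment (n : ℕ) {r : ℝ} (hr : 0 < r) (t : ℝ) :
    HasDerivAt (gaussMoment μ n r)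
      (n * gaussMoment μ (n - 1) r t - r ^ 2 * gaussMoment μ (n + 1) r t) t := by
  obtain ⟨C, hC⟩ := exists_abs_pow_mul_gaussKer_le hr (n - 1)
  obtain ⟨D, hD⟩ := exists_abs_pow_mul_gaussKer_le hr (n + 1)
  have h := (hasDerivAt_integral_of_dominated_loc_of_deriv_le (μ := μ) (𝕜 := ℝ)
    (F := fun s x => (s - x) ^ n * gaussKer r (s - x))
    (F' := fun s x => n * (s - x) ^ (n - 1) * gaussKer r (s - x)
      + (s - x) ^ n * (-(r ^ 2 * (s - x)) * gaussKer r (s - x)))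
    (s := Set.univ) (x₀ := t) (bound := fun _ => n * C + r ^ 2 * D)
    Filter.univ_mem
    (Filter.Eventually.of_forall fun s => by fun_prop)
    (integrable_pow_mul_gaussKer hr n t) (by fun_prop)
    (ae_of_all _ fun x s hs => ?_) (integrable_const _)
    (ae_of_all _ fun x s hs => ?_)).2
  · refine h.congr_deriv ?_
    unfold gaussMoment
    rw [← integral_const_mul, ← integral_const_mul, ← integral_sub
      ((integrable_pow_mul_gaussKer hr _ t).const_mul _)
      ((integrable_pow_mul_gaussKer hr _ t).const_mul _)]
    congr with x
    ring
  · refine (norm_add_le _ _).trans ?_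
    simp only [norm_mul, norm_neg, norm_pow, norm_eq_abs, abs_of_pos hr, Nat.abs_cast,
      abs_of_pos (gaussKer_pos _ _)]
    have h1 := mul_le_mul_of_nonneg_left (hC (s - x)) (Nat.cast_nonneg (α := ℝ) n)
    have h2 := mul_le_mul_of_nonneg_left (hD (s - x)) (sq_nonneg r)
    calc _ = n * (|s - x| ^ (n - 1) * gaussKer r (s - x))
          + r ^ 2 * (|s - x| ^ (n + 1) * gaussKer r (s - x)) := by ring
      _ ≤ _ := add_le_add h1 h2
  · have h1 : HasDerivAt (fun s : ℝ => s - x) 1 s := (hasDerivAt_id s).sub_const x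
    have h2 : HasDerivAt (fun s : ℝ => gaussKer r (s - x))
        (-(r ^ 2 * (s - x)) * gaussKer r (s - x)) s := by
      simpa [Function.comp_def] using (hasDerivAt_gaussKer r (s - x)).comp s h1
    simpa using (h1.fun_pow n).fun_mul h2

lemma gaussMoment_one_sq_le {r : ℝ} (hr : 0 < r) (t : ℝ) :
    gaussMoment μ 1 r t ^ 2 / gaussMoment μ 0 r t ≤ gaussMoment μ 2 r t := by
  have hq := gaussMoment_zero_pos (μ := μ) hr t
  set m := gaussMoment μ 1 r t / gaussMoment μ 0 r t with hm
  have h : 0 ≤ ∫ x, ((t - x) - m) ^ 2 * gaussKer r (t - x) ∂μ :=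
    integral_nonneg fun x => mul_nonneg (sq_nonneg _) (gaussKer_pos _ _).le
  have e : ∫ x, ((t - x) - m) ^ 2 * gaussKer r (t - x) ∂μ = gaussMoment μ 2 r t
      - 2 * m * gaussMoment μ 1 r t + m ^ 2 * gaussMoment μ 0 r t := by
    have hi := fun n => integrable_pow_mul_gaussKer (μ := μ) hr n t
    have h1 : Integrable (fun x => (t - x) ^ 2 * gaussKer r (t - x)
        - 2 * m * ((t - x) ^ 1 * gaussKer r (t - x))) μ := (hi 2).sub ((hi 1).const_mul _)
    unfold gaussMoment
    rw [← integral_const_mul, ← integral_const_mul, ← integral_sub (hi 2) ((hi 1).const_mul _),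
      ← integral_add h1 ((hi 0).const_mul _)]
    congr with x
    ring
  have e2 : gaussMoment μ 2 r t - 2 * m * gaussMoment μ 1 r t + m ^ 2 * gaussMoment μ 0 r t
      = gaussMoment μ 2 r t - gaussMoment μ 1 r t ^ 2 / gaussMoment μ 0 r t := by
    rw [hm]
    field_simp
    ring
  linarith

lemma abs_log_gaussMoment_zero_le (hμ : Integrable (fun x => x ^ 2) μ) {r : ℝ} (hr : 0 < r)
    (t : ℝ) :
    |log (gaussMoment μ 0 r t)| ≤ r ^ 2 * (1 + ∫ x, x ^ 2 ∂μ) * (1 + t ^ 2) := by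
  have hq := gaussMoment_zero_pos (μ := μ) hr t
  have hq1 := gaussMoment_zero_le_one (μ := μ) hr t
  have hm : 0 ≤ ∫ x, x ^ 2 ∂μ := integral_nonneg fun x => sq_nonneg x
  rw [abs_of_nonpos (log_nonpos hq.le hq1), neg_le, le_log_iff_exp_le hq]
  set K := r ^ 2 * (t ^ 2 + ∫ x, x ^ 2 ∂μ) with hK
  have hi : Integrable (fun x => exp (-K) * (1 + (K - r ^ 2 * (t ^ 2 + x ^ 2)))) μ := by
    refine Integrable.const_mul ?_ _
    exact (integrable_const _).add ((integrable_const _).sub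
      (((integrable_const _).add hμ).const_mul _))
  have h : ∫ x, exp (-K) * (1 + (K - r ^ 2 * (t ^ 2 + x ^ 2))) ∂μ ≤ gaussMoment μ 0 r t := by
    refine integral_mono hi (integrable_pow_mul_gaussKer hr 0 t) fun x => ?_
    have h1 := add_one_le_exp (K - r ^ 2 * (t ^ 2 + x ^ 2))
    calc exp (-K) * (1 + (K - r ^ 2 * (t ^ 2 + x ^ 2)))
        ≤ exp (-K) * exp (K - r ^ 2 * (t ^ 2 + x ^ 2)) := by
          gcongr
          linarith
      _ = exp (-(r ^ 2 * (t ^ 2 + x ^ 2))) := by rw [← exp_add]; ring_nf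
      _ ≤ (t - x) ^ 0 * gaussKer r (t - x) := by
          rw [pow_zero, one_mul, gaussKer, exp_le_exp]
          nlinarith [mul_nonneg (sq_nonneg r) (sq_nonneg (t + x))]
  have e : ∫ x, exp (-K) * (1 + (K - r ^ 2 * (t ^ 2 + x ^ 2))) ∂μ = exp (-K) := by
    have h1 : Integrable (fun x => t ^ 2 + x ^ 2) μ := (integrable_const _).add hμ
    have h2 : Integrable (fun x => K - r ^ 2 * (t ^ 2 + x ^ 2)) μ :=
      (integrable_const _).sub (h1.const_mul _)
    clear_value K
    rw [integral_const_mul, integral_add (integrable_const _) h2,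
      integral_sub (integrable_const _) (h1.const_mul _), integral_const_mul (r ^ 2) (fun x => t ^ 2 + x ^ 2),
      integral_add (integrable_const _) hμ]
    simp [hK]
  rw [e] at h
  refine le_trans ?_ h
  rw [exp_le_exp, hK]
  nlinarith [mul_nonneg (sq_nonneg r) (mul_nonneg hm (sq_nonneg t)), sq_nonneg r]

/-- The function used to dominate the entropy integrands and their derivatives. -/
noncomputable def gaussEnvelope (μ : Measure ℝ) (r t : ℝ) : ℝ :=
  ∫ x, (1 + t ^ 2) * ((1 + (t - x) ^ 2) * gaussKer r (t - x)) ∂μ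

lemma gaussEnvelope_eq {r : ℝ} (hr : 0 < r) (t : ℝ) :
    gaussEnvelope μ r t = (1 + t ^ 2) * (gaussMoment μ 0 r t + gaussMoment μ 2 r t) := by
  unfold gaussEnvelope gaussMoment
  rw [integral_const_mul, ← integral_add (integrable_pow_mul_gaussKer hr _ t)
    (integrable_pow_mul_gaussKer hr _ t)]
  congr with x
  ring

lemma integrable_pow_mul_gaussKer_volume {r : ℝ} (hr : 0 < r) (n : ℕ) :
    Integrable (fun u => u ^ n * gaussKer r u) := by
  have h := integrable_rpow_mul_exp_neg_mul_sq (b := r ^ 2 / 2) (by positivity) (s := n)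
    (by have : (0 : ℝ) ≤ n := Nat.cast_nonneg n
        linarith)
  refine h.congr (ae_of_all _ fun u => ?_)
  simp only [rpow_natCast, gaussKer]
  ring_nf

lemma integrable_prod_comp_sub {f g : ℝ → ℝ} (hf : Integrable f μ) (hg : Integrable g) :
    Integrable (fun p : ℝ × ℝ => f p.1 * g (p.2 - p.1)) (μ.prod volume) := by
  have h := (measurePreserving_prod_neg_add μ (volume : Measure ℝ)).integrable_comp_of_integrable
    (hf.mul_prod hg)
  refine h.congr (ae_of_all _ fun p => ?_)
  simp [neg_add_eq_sub]

lemma integrable_prod_envelope (hμ : Integrable (fun x => x ^ 2) μ) {r : ℝ} (hr : 0 < r) :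
    Integrable (fun p : ℝ × ℝ => (1 + p.2 ^ 2) *
      ((1 + (p.2 - p.1) ^ 2) * gaussKer r (p.2 - p.1))) (μ.prod volume) := by
  have hg := integrable_pow_mul_gaussKer_volume hr
  have h1 := integrable_prod_comp_sub (f := fun x => 1 + 2 * x ^ 2)
    ((integrable_const _).add (hμ.const_mul 2)) ((hg 0).add (hg 2))
  have h2 := integrable_prod_comp_sub (integrable_const (μ := μ) (2 : ℝ)) ((hg 2).add (hg 4))
  refine (h1.add h2).mono' (Continuous.aestronglyMeasurable (by fun_prop))
    (ae_of_all _ fun p => ?_)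
  have hk := (gaussKer_pos r (p.2 - p.1)).le
  rw [norm_of_nonneg (by positivity)]
  simp only [Pi.add_apply]
  have : 1 + p.2 ^ 2 ≤ (1 + 2 * p.1 ^ 2) + 2 * (p.2 - p.1) ^ 2 := by
    nlinarith [sq_nonneg (p.2 - 2 * p.1)]
  calc _ ≤ ((1 + 2 * p.1 ^ 2) + 2 * (p.2 - p.1) ^ 2) *
        ((1 + (p.2 - p.1) ^ 2) * gaussKer r (p.2 - p.1)) := by gcongr
    _ = _ := by ring

lemma integrable_gaussEnvelope (hμ : Integrable (fun x => x ^ 2) μ) {r : ℝ} (hr : 0 < r) :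
    Integrable (gaussEnvelope μ r) :=
  (integrable_prod_envelope hμ hr).integral_prod_right

lemma gaussMoment_anti {n : ℕ} (hn : Even n) {a r : ℝ} (ha : 0 < a) (har : a ≤ r) (t : ℝ) :
    gaussMoment μ n r t ≤ gaussMoment μ n a t :=
  integral_mono (integrable_pow_mul_gaussKer (ha.trans_le har) n t)
    (integrable_pow_mul_gaussKer ha n t)
    fun _ => mul_le_mul_of_nonneg_left (gaussKer_anti ha.le har _) (hn.pow_nonneg _)

omit [IsProbabilityMeasure μ] in
lemma gaussMoment_two_nonneg (r t : ℝ) : 0 ≤ gaussMoment μ 2 r t :=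
  integral_nonneg fun _ => mul_nonneg (sq_nonneg _) (gaussKer_pos _ _).le

lemma gaussMoment_add_le_gaussEnvelope {a r : ℝ} (ha : 0 < a) (har : a ≤ r) (t : ℝ) :
    (1 + t ^ 2) * (gaussMoment μ 0 r t + gaussMoment μ 2 r t) ≤ gaussEnvelope μ a t := by
  rw [gaussEnvelope_eq ha]
  have h0 := gaussMoment_anti (μ := μ) Even.zero ha har t
  have h2 := gaussMoment_anti (μ := μ) even_two ha har t
  gcongr

lemma abs_gaussMoment_one_le {r : ℝ} (hr : 0 < r) (t : ℝ) :
    |gaussMoment μ 1 r t| ≤ gaussMoment μ 0 r t + gaussMoment μ 2 r t := by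
  have hq := gaussMoment_zero_pos (μ := μ) hr t
  have hB := gaussMoment_two_nonneg (μ := μ) r t
  have h := gaussMoment_one_sq_le (μ := μ) hr t
  rw [div_le_iff₀ hq] at h
  exact abs_le_of_sq_le_sq (by nlinarith) (by positivity)

lemma integrable_of_abs_le_gaussEnvelope (hμ : Integrable (fun x => x ^ 2) μ) {r : ℝ} (hr : 0 < r)
    {f : ℝ → ℝ} (hf : Measurable f) (K : ℝ) (h : ∀ t, |f t| ≤ K * gaussEnvelope μ r t) :
    Integrable f :=
  ((integrable_gaussEnvelope hμ hr).const_mul K).mono' hf.aestronglyMeasurable (ae_of_all _ h)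

lemma integrable_gaussMoment_two (hμ : Integrable (fun x => x ^ 2) μ) {r : ℝ} (hr : 0 < r) :
    Integrable (gaussMoment μ 2 r) := by
  refine integrable_of_abs_le_gaussEnvelope hμ hr (measurable_gaussMoment 2 r) 1 fun t => ?_
  have hq := gaussMoment_zero_pos (μ := μ) hr t
  have hB := gaussMoment_two_nonneg (μ := μ) r t
  rw [abs_of_nonneg hB, one_mul]
  refine le_trans ?_ (gaussMoment_add_le_gaussEnvelope hr le_rfl t)
  nlinarith [mul_nonneg (sq_nonneg t) (add_nonneg hq.le hB)]

lemma integrable_gaussMoment_one_sq_div (hμ : Integrable (fun x => x ^ 2) μ) {r : ℝ} (hr : 0 < r) :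
    Integrable (fun t => gaussMoment μ 1 r t ^ 2 / gaussMoment μ 0 r t) := by
  refine (integrable_gaussMoment_two hμ hr).mono'
    (((measurable_gaussMoment 1 r).pow_const 2).div
      (measurable_gaussMoment 0 r)).aestronglyMeasurable (ae_of_all _ fun t => ?_)
  have hq := gaussMoment_zero_pos (μ := μ) hr t
  rw [norm_of_nonneg (by positivity)]
  exact gaussMoment_one_sq_le hr t

lemma integrable_mul_log_gaussMoment (hμ : Integrable (fun x => x ^ 2) μ) {r : ℝ} (hr : 0 < r)
    {f : ℝ → ℝ} (hf : Measurable f)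
    (h : ∀ t, |f t| ≤ gaussMoment μ 0 r t + gaussMoment μ 2 r t) :
    Integrable (fun t => f t * log (gaussMoment μ 0 r t)) := by
  have hm : 0 ≤ ∫ x, x ^ 2 ∂μ := integral_nonneg fun x => sq_nonneg x
  refine integrable_of_abs_le_gaussEnvelope hμ hr (hf.mul (measurable_gaussMoment 0 r).log)
    (r ^ 2 * (1 + ∫ x, x ^ 2 ∂μ)) fun t => ?_
  rw [gaussEnvelope_eq hr, abs_mul, ← mul_assoc, mul_comm]
  exact mul_le_mul (abs_log_gaussMoment_zero_le hμ hr t) (h t) (abs_nonneg _) (by positivity)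

lemma integral_gaussMoment_mul_log (hμ : Integrable (fun x => x ^ 2) μ) {r : ℝ} (hr : 0 < r) :
    r ^ 2 * ∫ t, gaussMoment μ 1 r t ^ 2 / gaussMoment μ 0 r t =
      ∫ t, (gaussMoment μ 0 r t - r ^ 2 * gaussMoment μ 2 r t) * log (gaussMoment μ 0 r t) := by
  have hq := gaussMoment_zero_pos (μ := μ) hr
  have hB := gaussMoment_two_nonneg (μ := μ) r
  have h := integral_mul_deriv_eq_deriv_mul_of_integrable (u := gaussMoment μ 1 r)
    (v := fun t => log (gaussMoment μ 0 r t))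
    (u' := fun t => gaussMoment μ 0 r t - r ^ 2 * gaussMoment μ 2 r t)
    (v' := fun t => -r ^ 2 * gaussMoment μ 1 r t / gaussMoment μ 0 r t)
    (fun t _ => by simpa using hasDerivAt_gaussMoment (μ := μ) 1 hr t)
    (fun t _ => by simpa using (hasDerivAt_gaussMoment (μ := μ) 0 hr t).log (hq t).ne')
    (((integrable_gaussMoment_one_sq_div hμ hr).const_mul (-r ^ 2)).congr
      (ae_of_all _ fun t => by simp only [Pi.mul_apply]; ring))
    (((integrable_mul_log_gaussMoment hμ hr (measurable_gaussMoment 0 r)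
      fun t => by rw [abs_of_pos (hq t)]; linarith [hB t]).sub
      ((integrable_mul_log_gaussMoment hμ hr (measurable_gaussMoment 2 r)
      fun t => by rw [abs_of_nonneg (hB t)]; linarith [hq t]).const_mul (r ^ 2))).congr
      (ae_of_all _ fun t => by simp only [Pi.mul_apply, Pi.sub_apply]; ring))
    (integrable_mul_log_gaussMoment hμ hr (measurable_gaussMoment 1 r)
      (abs_gaussMoment_one_le hr))
  rw [← neg_eq_iff_eq_neg] at h
  rw [← h, ← integral_const_mul, ← integral_neg]
  congr with t
  ring

lemma hasDerivAt_integral_gaussMoment_mul_log (hμ : Integrable (fun x => x ^ 2) μ) {r : ℝ}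
    (hr : 0 < r) :
    HasDerivAt (fun s => ∫ t, gaussMoment μ 0 s t * log (gaussMoment μ 0 s t))
      (∫ t, -r * gaussMoment μ 2 r t * (1 + log (gaussMoment μ 0 r t))) r := by
  have hm : 0 ≤ ∫ x, x ^ 2 ∂μ := integral_nonneg fun x => sq_nonneg x
  have ha := half_pos hr
  have meas := fun n s => measurable_gaussMoment (μ := μ) n s
  refine (hasDerivAt_integral_of_dominated_loc_of_deriv_le (𝕜 := ℝ)
    (F := fun s t => gaussMoment μ 0 s t * log (gaussMoment μ 0 s t))
    (F' := fun s t => -s * gaussMoment μ 2 s t * (1 + log (gaussMoment μ 0 s t)))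
    (s := Set.Ioo (r / 2) (2 * r)) (x₀ := r)
    (bound := fun t => (2 * r) * (1 + (2 * r) ^ 2 * (1 + ∫ x, x ^ 2 ∂μ))
      * gaussEnvelope μ (r / 2) t)
    (Ioo_mem_nhds (by linarith) (by linarith))
    (Filter.Eventually.of_forall fun s => ((meas 0 s).mul (meas 0 s).log).aestronglyMeasurable)
    (integrable_mul_log_gaussMoment hμ hr (meas 0 r) fun t => ?_)
    ((((meas 2 r).const_mul _).mul ((meas 0 r).log.const_add 1)).aestronglyMeasurable)
    (ae_of_all _ fun t s hs => ?_)
    ((integrable_gaussEnvelope hμ ha).const_mul _)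
    (ae_of_all _ fun t s hs => ?_)).2
  · rw [abs_of_pos (gaussMoment_zero_pos hr t)]
    linarith [gaussMoment_two_nonneg (μ := μ) r t]
  · have hs0 : 0 < s := ha.trans hs.1
    have hq := gaussMoment_zero_pos (μ := μ) hs0 t
    have hB := gaussMoment_two_nonneg (μ := μ) s t
    have hlog := abs_log_gaussMoment_zero_le hμ hs0 t
    have henv := gaussMoment_add_le_gaussEnvelope (μ := μ) ha hs.1.le t
    have h1 : |1 + log (gaussMoment μ 0 s t)|
        ≤ (1 + (2 * r) ^ 2 * (1 + ∫ x, x ^ 2 ∂μ)) * (1 + t ^ 2) := by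
      calc _ ≤ |(1 : ℝ)| + |log (gaussMoment μ 0 s t)| := abs_add_le _ _
        _ ≤ 1 + (2 * r) ^ 2 * (1 + ∫ x, x ^ 2 ∂μ) * (1 + t ^ 2) := by
          rw [abs_one]
          refine add_le_add_right (hlog.trans ?_) _
          have := hs.2.le
          gcongr
        _ ≤ _ := by nlinarith [sq_nonneg t]
    have hK : 0 ≤ 1 + (2 * r) ^ 2 * (1 + ∫ x, x ^ 2 ∂μ) := by positivity
    calc ‖-s * gaussMoment μ 2 s t * (1 + log (gaussMoment μ 0 s t))‖
        = s * gaussMoment μ 2 s t * |1 + log (gaussMoment μ 0 s t)| := by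
          rw [norm_mul, norm_mul, norm_neg, norm_of_nonneg hs0.le, norm_of_nonneg hB, norm_eq_abs]
      _ ≤ (2 * r) * (gaussMoment μ 0 s t + gaussMoment μ 2 s t)
          * ((1 + (2 * r) ^ 2 * (1 + ∫ x, x ^ 2 ∂μ)) * (1 + t ^ 2)) := by
          have := hs.2.le
          gcongr
          linarith
      _ = (2 * r) * (1 + (2 * r) ^ 2 * (1 + ∫ x, x ^ 2 ∂μ))
          * ((1 + t ^ 2) * (gaussMoment μ 0 s t + gaussMoment μ 2 s t)) := by ring
      _ ≤ _ := by gcongr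
  · have hs0 : 0 < s := ha.trans hs.1
    have hq := gaussMoment_zero_pos (μ := μ) hs0 t
    have hd := hasDerivAt_gaussMoment_scale (μ := μ) 0 hs0 t
    refine (hd.fun_mul (hd.log hq.ne')).congr_deriv ?_
    field_simp
    ring

lemma hasDerivAt_mul_integral_gaussMoment_mul_log (hμ : Integrable (fun x => x ^ 2) μ) {r : ℝ}
    (hr : 0 < r) :
    HasDerivAt (fun s => s * ∫ t, gaussMoment μ 0 s t * log (gaussMoment μ 0 s t))
      (-(r ^ 2 * ∫ t, (gaussMoment μ 2 r t
        - gaussMoment μ 1 r t ^ 2 / gaussMoment μ 0 r t))) r := by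
  have hq := gaussMoment_zero_pos (μ := μ) hr
  have hB := gaussMoment_two_nonneg (μ := μ) r
  have hi0 := integrable_mul_log_gaussMoment hμ hr (measurable_gaussMoment 0 r)
    fun t => by rw [abs_of_pos (hq t)]; linarith [hB t]
  have hi2 := integrable_mul_log_gaussMoment hμ hr (measurable_gaussMoment 2 r)
    fun t => by rw [abs_of_nonneg (hB t)]; linarith [hq t]
  have hiB := integrable_gaussMoment_two hμ hr
  refine ((hasDerivAt_id' r).fun_mul
    (hasDerivAt_integral_gaussMoment_mul_log hμ hr)).congr_deriv ?_
  have e1 : ∫ t, -r * gaussMoment μ 2 r t * (1 + log (gaussMoment μ 0 r t)) =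
      (-r * ∫ t, gaussMoment μ 2 r t) +
        -r * ∫ t, gaussMoment μ 2 r t * log (gaussMoment μ 0 r t) := by
    rw [← integral_const_mul, ← integral_const_mul,
      ← integral_add (hiB.const_mul _) (hi2.const_mul _)]
    congr with t
    ring
  have e2 := integral_gaussMoment_mul_log hμ hr
  have e3 : ∫ t, (gaussMoment μ 0 r t - r ^ 2 * gaussMoment μ 2 r t)
        * log (gaussMoment μ 0 r t) =
      (∫ t, gaussMoment μ 0 r t * log (gaussMoment μ 0 r t))
        - r ^ 2 * ∫ t, gaussMoment μ 2 r t * log (gaussMoment μ 0 r t) := by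
    rw [← integral_const_mul, ← integral_sub hi0 (hi2.const_mul _)]
    congr with t
    ring
  rw [integral_sub hiB (integrable_gaussMoment_one_sq_div hμ hr), e1]
  linear_combination -e2 - e3

end Moments

section Channel

variable {Ω : Type*} [MeasurableSpace Ω] {P : Measure Ω} [IsProbabilityMeasure P] {X Z : Ω → ℝ}

lemma map_div_gaussianReal {r : ℝ} (hr : 0 < r) (x : ℝ) :
    (gaussianReal 0 1).map (fun z => x + z / r) =
      volume.withDensity (fun t => ENNReal.ofReal (r / √(2 * π) * gaussKer r (t - x))) := by
  have h : (fun z => x + z / r) = (fun z => x + z) ∘ (fun z => z / r) := rfl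
  rw [h, ← Measure.map_map (by fun_prop) (by fun_prop), gaussianReal_map_div_const,
    gaussianReal_map_const_add, gaussianReal_of_var_ne_zero _ (by
      simp only [ne_eq, div_eq_zero_iff, one_ne_zero, false_or]
      exact fun h => (pow_pos hr 2).ne' (congrArg NNReal.toReal h))]
  congr 1 with t
  rw [gaussianPDF, gaussianPDFReal, gaussKer]
  congr 1
  have e : ((1 / NNReal.mk (r ^ 2) (sq_nonneg r) : NNReal) : ℝ) = 1 / r ^ 2 := rfl
  rw [e, show 2 * π * (1 / r ^ 2) = 2 * π / r ^ 2 by ring, sqrt_div (by positivity),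
    sqrt_sq hr.le, inv_div, zero_div, zero_add]
  congr 2
  field_simp

lemma map_channel (hX : Measurable X) (hZ : Measurable Z) (hindep : IndepFun X Z P)
    (hZlaw : P.map Z = gaussianReal 0 1) {r : ℝ} (hr : 0 < r) :
    P.map (fun ω => (X ω, X ω + Z ω / r)) = ((P.map X).prod volume).withDensity
      (fun p => ENNReal.ofReal (r / √(2 * π) * gaussKer r (p.2 - p.1))) := by
  have : IsProbabilityMeasure (P.map X) := Measure.isProbabilityMeasure_map hX.aemeasurable
  have hprod := (indepFun_iff_map_prod_eq_prod_map_map hX.aemeasurable hZ.aemeasurable).1 hindep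
  have h : (fun ω => (X ω, X ω + Z ω / r)) =
      (fun p : ℝ × ℝ => (p.1, p.1 + p.2 / r)) ∘ (fun ω => (X ω, Z ω)) := rfl
  have hm : Measurable (fun p : ℝ × ℝ => (p.1, p.1 + p.2 / r)) := by fun_prop
  rw [h, ← Measure.map_map hm (hX.prodMk hZ), hprod, hZlaw]
  ext s hs
  rw [Measure.map_apply hm hs, Measure.prod_apply (hm hs), withDensity_apply _ hs,
    ← lintegral_indicator hs, lintegral_prod _ (by
      refine (Measurable.indicator ?_ hs).aemeasurable
      fun_prop)]
  congr with x
  have hx := map_div_gaussianReal hr x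
  have hsx : MeasurableSet (Prod.mk x ⁻¹' s) := measurable_prodMk_left hs
  have e : Prod.mk x ⁻¹' ((fun p : ℝ × ℝ => (p.1, p.1 + p.2 / r)) ⁻¹' s) =
      (fun z => x + z / r) ⁻¹' (Prod.mk x ⁻¹' s) := rfl
  rw [e, ← Measure.map_apply (by fun_prop) hsx, hx, withDensity_apply _ hsx,
    ← lintegral_indicator hsx]
  rfl

lemma map_channel_output (hX : Measurable X) (hZ : Measurable Z) (hindep : IndepFun X Z P)
    (hZlaw : P.map Z = gaussianReal 0 1) {r : ℝ} (hr : 0 < r) :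
    P.map (fun ω => X ω + Z ω / r) = volume.withDensity
      (fun t => ENNReal.ofReal (r / √(2 * π) * gaussMoment (P.map X) 0 r t)) := by
  have : IsProbabilityMeasure (P.map X) := Measure.isProbabilityMeasure_map hX.aemeasurable
  have h : (fun ω => X ω + Z ω / r) = Prod.snd ∘ (fun ω => (X ω, X ω + Z ω / r)) := rfl
  rw [h, ← Measure.map_map measurable_snd (by fun_prop), map_channel hX hZ hindep hZlaw hr]
  ext s hs
  rw [Measure.map_apply measurable_snd hs, withDensity_apply _ (measurable_snd hs),
    withDensity_apply _ hs, ← Set.univ_prod, ← Measure.prod_restrict, Measure.restrict_univ,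
    lintegral_prod_symm _ (by fun_prop)]
  congr with t
  have hi := (integrable_pow_mul_gaussKer (μ := P.map X) hr 0 t).const_mul (r / √(2 * π))
  simp only [pow_zero, one_mul] at hi
  rw [← ofReal_integral_eq_lintegral_ofReal hi
    (ae_of_all _ fun x => mul_nonneg (by positivity) (gaussKer_pos _ _).le),
    integral_const_mul]
  simp [gaussMoment]

lemma map_channel_eq_withDensity_prod (hX : Measurable X) (hZ : Measurable Z)
    (hindep : IndepFun X Z P) (hZlaw : P.map Z = gaussianReal 0 1) {r : ℝ} (hr : 0 < r) :
    P.map (fun ω => (X ω, X ω + Z ω / r)) =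
      ((P.map X).prod (P.map (fun ω => X ω + Z ω / r))).withDensity
      (fun p => ENNReal.ofReal (gaussKer r (p.2 - p.1) / gaussMoment (P.map X) 0 r p.2)) := by
  have : IsProbabilityMeasure (P.map X) := Measure.isProbabilityMeasure_map hX.aemeasurable
  have hq := measurable_gaussMoment (μ := P.map X) 0 r
  have hm : Measurable (fun t => ENNReal.ofReal (r / √(2 * π) * gaussMoment (P.map X) 0 r t)) := by
    fun_prop
  have hfin : SFinite (volume.withDensity
      (fun t => ENNReal.ofReal (r / √(2 * π) * gaussMoment (P.map X) 0 r t))) := inferInstance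
  rw [map_channel_output hX hZ hindep hZlaw hr, map_channel hX hZ hindep hZlaw hr,
    prod_withDensity_right hm, ← withDensity_mul _ (by fun_prop) (by fun_prop)]
  congr with p
  have hq0 := gaussMoment_zero_pos (μ := P.map X) hr p.2
  rw [Pi.mul_apply, ← ENNReal.ofReal_mul (by positivity)]
  congr 1
  field_simp

lemma mutualInfo_comp_measurableEquiv {α β γ : Type*} [MeasurableSpace α] [MeasurableSpace β]
    [MeasurableSpace γ] {X : Ω → α} {Y : Ω → β} (hX : Measurable X) (hY : Measurable Y)
    (e : β ≃ᵐ γ)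
    (hac : P.map (fun ω => (X ω, Y ω)) ≪ (P.map X).prod (P.map Y)) :
    mutualInfo P X (fun ω => e (Y ω)) = mutualInfo P X Y := by
  have : IsProbabilityMeasure (P.map X) := Measure.isProbabilityMeasure_map hX.aemeasurable
  have : IsProbabilityMeasure (P.map Y) := Measure.isProbabilityMeasure_map hY.aemeasurable
  have : IsProbabilityMeasure (P.map fun ω => (X ω, Y ω)) :=
    Measure.isProbabilityMeasure_map (hX.prodMk hY).aemeasurable
  let f : α × β ≃ᵐ α × γ := (MeasurableEquiv.refl α).prodCongr e
  have h1 : P.map (fun ω => (X ω, e (Y ω))) = (P.map (fun ω => (X ω, Y ω))).map f :=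
    (Measure.map_map f.measurable (hX.prodMk hY)).symm
  have h2 : (P.map X).prod (P.map (fun ω => e (Y ω))) = ((P.map X).prod (P.map Y)).map f := by
    have h3 : P.map (fun ω => e (Y ω)) = (P.map Y).map e :=
      (Measure.map_map e.measurable hY).symm
    conv_lhs => rw [h3, ← Measure.map_id (μ := P.map X)]
    exact Measure.map_prod_map _ _ measurable_id e.measurable
  have h4 := f.measurableEmbedding.rnDeriv_map (P.map (fun ω => (X ω, Y ω)))
    ((P.map X).prod (P.map Y))
  have h5 := ae_of_ae_map (hX.prodMk hY).aemeasurable (hac.ae_le h4)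
  unfold mutualInfo
  rw [h1, h2]
  refine integral_congr_ae (h5.mono fun ω hω => ?_)
  exact congrArg (fun a => log (ENNReal.toReal a)) hω

lemma integrable_channel_iff (hX : Measurable X) (hZ : Measurable Z) (hindep : IndepFun X Z P)
    (hZlaw : P.map Z = gaussianReal 0 1) {r : ℝ} (hr : 0 < r) {f : ℝ × ℝ → ℝ}
    (hf : Measurable f) :
    Integrable (fun ω => f (X ω, X ω + Z ω / r)) P ↔
      Integrable (fun p => gaussKer r (p.2 - p.1) * f p) ((P.map X).prod volume) := by
  have h1 := integrable_map_measure (μ := P) (f := fun ω => (X ω, X ω + Z ω / r)) (g := f)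
    hf.aestronglyMeasurable (by fun_prop)
  have h2 : (fun ω => f (X ω, X ω + Z ω / r)) = f ∘ (fun ω => (X ω, X ω + Z ω / r)) := rfl
  rw [h2, ← h1, map_channel hX hZ hindep hZlaw hr, integrable_withDensity_iff_integrable_smul'
    (by fun_prop) (ae_of_all _ fun p => ENNReal.ofReal_lt_top)]
  have hc : r / √(2 * π) ≠ 0 := by positivity
  rw [← integrable_const_mul_iff (IsUnit.mk0 _ hc) (fun p => gaussKer r (p.2 - p.1) * f p)]
  refine integrable_congr (ae_of_all _ fun p => ?_)
  beta_reduce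
  rw [ENNReal.toReal_ofReal (mul_nonneg (by positivity) (gaussKer_pos _ _).le), smul_eq_mul,
    mul_assoc]

lemma integral_channel (hX : Measurable X) (hZ : Measurable Z) (hindep : IndepFun X Z P)
    (hZlaw : P.map Z = gaussianReal 0 1) {r : ℝ} (hr : 0 < r) {f : ℝ × ℝ → ℝ}
    (hf : Measurable f) :
    ∫ ω, f (X ω, X ω + Z ω / r) ∂P =
      r / √(2 * π) * ∫ p, gaussKer r (p.2 - p.1) * f p ∂((P.map X).prod volume) := by
  rw [← integral_map (φ := fun ω => (X ω, X ω + Z ω / r)) (by fun_prop) hf.aestronglyMeasurable,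
    map_channel hX hZ hindep hZlaw hr, integral_withDensity_eq_integral_toReal_smul
    (by fun_prop) (ae_of_all _ fun p => ENNReal.ofReal_lt_top), ← integral_const_mul]
  congr with p
  rw [ENNReal.toReal_ofReal (mul_nonneg (by positivity) (gaussKer_pos _ _).le), smul_eq_mul,
    mul_assoc]

omit [IsProbabilityMeasure P] in
lemma integrable_map_sq (hX : Measurable X) (hX2 : Integrable (fun ω => X ω ^ 2) P) :
    Integrable (fun x => x ^ 2) (P.map X) :=
  (integrable_map_measure (by fun_prop) hX.aemeasurable).2 hX2

lemma mutualInfo_channel (hX : Measurable X) (hZ : Measurable Z) (hindep : IndepFun X Z P)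
    (hZlaw : P.map Z = gaussianReal 0 1) (hX2 : Integrable (fun ω => X ω ^ 2) P)
    {r : ℝ} (hr : 0 < r) :
    mutualInfo P X (fun ω => r * X ω + Z ω) = (∫ ω, -(Z ω ^ 2) / 2 ∂P) - (√(2 * π))⁻¹ *
      (r * ∫ t, gaussMoment (P.map X) 0 r t * log (gaussMoment (P.map X) 0 r t)) := by
  have : IsProbabilityMeasure (P.map X) := Measure.isProbabilityMeasure_map hX.aemeasurable
  have hμ := integrable_map_sq hX hX2
  have hT : Measurable (fun ω => X ω + Z ω / r) := by fun_prop
  have hprob : IsProbabilityMeasure (P.map (fun ω => X ω + Z ω / r)) :=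
    Measure.isProbabilityMeasure_map hT.aemeasurable
  have hq := measurable_gaussMoment (μ := P.map X) 0 r
  have hjoint := map_channel_eq_withDensity_prod hX hZ hindep hZlaw hr
  have hac : P.map (fun ω => (X ω, X ω + Z ω / r)) ≪
      (P.map X).prod (P.map (fun ω => X ω + Z ω / r)) :=
    hjoint ▸ withDensity_absolutelyContinuous _ _
  have hscale : (fun ω => r * X ω + Z ω) =
      fun ω => (MeasurableEquiv.mulLeft₀ r hr.ne') (X ω + Z ω / r) := by
    ext ω
    simp only [MeasurableEquiv.coe_mulLeft₀]
    field_simp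
  rw [hscale, mutualInfo_comp_measurableEquiv hX hT _ hac]
  have hrn : ∀ᵐ ω ∂P, log ((P.map (fun ω => (X ω, X ω + Z ω / r))).rnDeriv
      ((P.map X).prod (P.map fun ω => X ω + Z ω / r)) (X ω, X ω + Z ω / r)).toReal =
      -(Z ω ^ 2) / 2 - log (gaussMoment (P.map X) 0 r (X ω + Z ω / r)) := by
    have h := Measure.rnDeriv_withDensity ((P.map X).prod (P.map (fun ω => X ω + Z ω / r)))
      (f := fun p => ENNReal.ofReal
        (gaussKer r (p.2 - p.1) / gaussMoment (P.map X) 0 r p.2)) (by fun_prop)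
    rw [← hjoint] at h
    filter_upwards [ae_of_ae_map (hX.prodMk hT).aemeasurable (hac.ae_le h)] with ω hω
    have hq0 := gaussMoment_zero_pos (μ := P.map X) hr (X ω + Z ω / r)
    rw [hω, ENNReal.toReal_ofReal (div_nonneg (gaussKer_pos _ _).le hq0.le),
      log_div (gaussKer_pos _ _).ne' hq0.ne', log_gaussKer]
    congr 1
    simp only [add_sub_cancel_left]
    field_simp
  have hZ2 : Integrable (fun ω => -(Z ω ^ 2) / 2) P := by
    have h := (memLp_id_gaussianReal (μ := 0) (v := 1) 2).integrable_sq
    rw [← hZlaw, integrable_map_measure (by fun_prop) hZ.aemeasurable] at h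
    exact h.neg.div_const 2
  have hlog : Measurable (fun p : ℝ × ℝ => log (gaussMoment (P.map X) 0 r p.2)) := by fun_prop
  have hi : Integrable (fun p : ℝ × ℝ => gaussKer r (p.2 - p.1) *
      log (gaussMoment (P.map X) 0 r p.2)) ((P.map X).prod volume) := by
    refine ((integrable_prod_envelope hμ hr).const_mul
      (r ^ 2 * (1 + ∫ x, x ^ 2 ∂(P.map X)))).mono'
      (Measurable.aestronglyMeasurable (by fun_prop)) (ae_of_all _ fun p => ?_)
    have hm : 0 ≤ ∫ x, x ^ 2 ∂(P.map X) := integral_nonneg fun x => sq_nonneg x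
    have hk := gaussKer_pos r (p.2 - p.1)
    rw [norm_mul, norm_of_nonneg hk.le, norm_eq_abs]
    calc _ ≤ gaussKer r (p.2 - p.1) * (r ^ 2 * (1 + ∫ x, x ^ 2 ∂(P.map X)) * (1 + p.2 ^ 2)) := by
          gcongr
          exact abs_log_gaussMoment_zero_le hμ hr _
      _ = r ^ 2 * (1 + ∫ x, x ^ 2 ∂(P.map X)) *
          ((1 + p.2 ^ 2) * (1 * gaussKer r (p.2 - p.1))) := by ring
      _ ≤ _ := by
          gcongr
          nlinarith [sq_nonneg (p.2 - p.1)]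
  unfold mutualInfo
  rw [integral_congr_ae hrn, integral_sub hZ2
    ((integrable_channel_iff hX hZ hindep hZlaw hr hlog).2 hi),
    integral_channel hX hZ hindep hZlaw hr hlog, integral_prod_symm _ hi]
  have e : ∀ t, ∫ x, gaussKer r (t - x) * log (gaussMoment (P.map X) 0 r t) ∂(P.map X) =
      gaussMoment (P.map X) 0 r t * log (gaussMoment (P.map X) 0 r t) := fun t => by
    rw [integral_mul_const]
    simp [gaussMoment]
  simp only [e]
  ring

/-- The posterior mean of `X` given `X + Z / r = t`, when `X` has law `μ`. -/
noncomputable def posteriorMean (μ : Measure ℝ) (r t : ℝ) : ℝ :=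
  t - gaussMoment μ 1 r t / gaussMoment μ 0 r t

lemma measurable_posteriorMean (μ : Measure ℝ) [IsProbabilityMeasure μ] (r : ℝ) :
    Measurable (posteriorMean μ r) :=
  measurable_id.sub ((measurable_gaussMoment 1 r).div (measurable_gaussMoment 0 r))

lemma integral_gaussKer_mul_sub_posteriorMean (μ : Measure ℝ) [IsProbabilityMeasure μ] {r : ℝ}
    (hr : 0 < r) (t : ℝ) : ∫ x, gaussKer r (t - x) * (x - posteriorMean μ r t) ∂μ = 0 := by
  have hq := gaussMoment_zero_pos (μ := μ) hr t
  have hi := fun n => integrable_pow_mul_gaussKer (μ := μ) hr n t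
  have e : ∫ x, gaussKer r (t - x) * (x - posteriorMean μ r t) ∂μ =
      gaussMoment μ 1 r t / gaussMoment μ 0 r t * gaussMoment μ 0 r t - gaussMoment μ 1 r t := by
    conv_rhs => rw [gaussMoment.eq_1 μ 1, gaussMoment.eq_1 μ 0]
    rw [← integral_const_mul, ← integral_sub ((hi 0).const_mul _) (hi 1)]
    congr with x
    unfold posteriorMean gaussMoment
    ring
  rw [e]
  field_simp
  ring

lemma integrable_sq_sub_posteriorMean (μ : Measure ℝ) [IsProbabilityMeasure μ]
    {r : ℝ} (hr : 0 < r) (t : ℝ) :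
    Integrable (fun x => gaussKer r (t - x) * (x - posteriorMean μ r t) ^ 2) μ := by
  have hi := fun n => integrable_pow_mul_gaussKer (μ := μ) hr n t
  refine (((hi 2).sub ((hi 1).const_mul (2 * (t - posteriorMean μ r t)))).add
    ((hi 0).const_mul ((t - posteriorMean μ r t) ^ 2))).congr (ae_of_all _ fun x => ?_)
  simp only [Pi.add_apply, Pi.sub_apply]
  ring

lemma integral_gaussKer_mul_sq_sub_posteriorMean (μ : Measure ℝ) [IsProbabilityMeasure μ]
    {r : ℝ} (hr : 0 < r) (t : ℝ) :
    ∫ x, gaussKer r (t - x) * (x - posteriorMean μ r t) ^ 2 ∂μ =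
      gaussMoment μ 2 r t - gaussMoment μ 1 r t ^ 2 / gaussMoment μ 0 r t := by
  have hq := gaussMoment_zero_pos (μ := μ) hr t
  have hi := fun n => integrable_pow_mul_gaussKer (μ := μ) hr n t
  obtain ⟨m, hm⟩ : ∃ m, m = gaussMoment μ 1 r t / gaussMoment μ 0 r t := ⟨_, rfl⟩
  have h1 : Integrable (fun x => (t - x) ^ 2 * gaussKer r (t - x)
      - 2 * m * ((t - x) ^ 1 * gaussKer r (t - x))) μ := (hi 2).sub ((hi 1).const_mul _)
  have e : ∫ x, gaussKer r (t - x) * (x - posteriorMean μ r t) ^ 2 ∂μ = gaussMoment μ 2 r t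
      - 2 * m * gaussMoment μ 1 r t + m ^ 2 * gaussMoment μ 0 r t := by
    rw [posteriorMean, ← hm]
    unfold gaussMoment
    rw [← integral_const_mul, ← integral_const_mul, ← integral_sub (hi 2) ((hi 1).const_mul _),
      ← integral_add h1 ((hi 0).const_mul _)]
    congr with x
    ring
  rw [e, hm]
  field_simp
  ring

lemma integrable_prod_sq_sub_posteriorMean {μ : Measure ℝ} [IsProbabilityMeasure μ]
    (hμ : Integrable (fun x => x ^ 2) μ) {r : ℝ} (hr : 0 < r) :
    Integrable (fun p : ℝ × ℝ => gaussKer r (p.2 - p.1) * (p.1 - posteriorMean μ r p.2) ^ 2)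
      (μ.prod volume) := by
  have hm := measurable_posteriorMean μ r
  refine (integrable_prod_iff' (by fun_prop)).2
    ⟨ae_of_all _ fun t => integrable_sq_sub_posteriorMean μ hr t, ?_⟩
  refine ((integrable_gaussMoment_two hμ hr).sub
    (integrable_gaussMoment_one_sq_div hμ hr)).congr (ae_of_all _ fun t => ?_)
  simp only [Pi.sub_apply]
  rw [← integral_gaussKer_mul_sq_sub_posteriorMean μ hr t]
  congr with x
  rw [norm_of_nonneg (mul_nonneg (gaussKer_pos _ _).le (sq_nonneg _))]

lemma integrable_sub_posteriorMean_sq (hX : Measurable X) (hZ : Measurable Z)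
    (hindep : IndepFun X Z P) (hZlaw : P.map Z = gaussianReal 0 1)
    (hX2 : Integrable (fun ω => X ω ^ 2) P) {r : ℝ} (hr : 0 < r) :
    Integrable (fun ω => (X ω - posteriorMean (P.map X) r (X ω + Z ω / r)) ^ 2) P := by
  have : IsProbabilityMeasure (P.map X) := Measure.isProbabilityMeasure_map hX.aemeasurable
  have hm := measurable_posteriorMean (P.map X) r
  exact (integrable_channel_iff hX hZ hindep hZlaw hr
    (f := fun p => (p.1 - posteriorMean (P.map X) r p.2) ^ 2) (by fun_prop)).2
    (integrable_prod_sq_sub_posteriorMean (integrable_map_sq hX hX2) hr)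

lemma integral_sub_posteriorMean_sq (hX : Measurable X) (hZ : Measurable Z)
    (hindep : IndepFun X Z P) (hZlaw : P.map Z = gaussianReal 0 1)
    (hX2 : Integrable (fun ω => X ω ^ 2) P) {r : ℝ} (hr : 0 < r) :
    ∫ ω, (X ω - posteriorMean (P.map X) r (X ω + Z ω / r)) ^ 2 ∂P = r / √(2 * π) *
      ∫ t, (gaussMoment (P.map X) 2 r t
        - gaussMoment (P.map X) 1 r t ^ 2 / gaussMoment (P.map X) 0 r t) := by
  have : IsProbabilityMeasure (P.map X) := Measure.isProbabilityMeasure_map hX.aemeasurable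
  have hm := measurable_posteriorMean (P.map X) r
  rw [integral_channel hX hZ hindep hZlaw hr
    (f := fun p => (p.1 - posteriorMean (P.map X) r p.2) ^ 2) (by fun_prop),
    integral_prod_symm _ (integrable_prod_sq_sub_posteriorMean (integrable_map_sq hX hX2) hr)]
  simp only [integral_gaussKer_mul_sq_sub_posteriorMean _ hr]

lemma posteriorMean_ae_eq_condExp (hX : Measurable X) (hZ : Measurable Z)
    (hindep : IndepFun X Z P) (hZlaw : P.map Z = gaussianReal 0 1)
    (hX2 : Integrable (fun ω => X ω ^ 2) P) {r : ℝ} (hr : 0 < r) :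
    (fun ω => posteriorMean (P.map X) r (X ω + Z ω / r)) =ᵐ[P]
      P[X | MeasurableSpace.comap (fun ω => r * X ω + Z ω) inferInstance] := by
  have : IsProbabilityMeasure (P.map X) := Measure.isProbabilityMeasure_map hX.aemeasurable
  have hm := measurable_posteriorMean (P.map X) r
  have hY : Measurable (fun ω => r * X ω + Z ω) := by fun_prop
  have hXi : Integrable X P :=
    ((memLp_two_iff_integrable_sq hX.aestronglyMeasurable).2 hX2).integrable one_le_two
  have hdi : Integrable (fun ω => X ω - posteriorMean (P.map X) r (X ω + Z ω / r)) P :=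
    ((memLp_two_iff_integrable_sq (by fun_prop)).2
      (integrable_sub_posteriorMean_sq hX hZ hindep hZlaw hX2 hr)).integrable one_le_two
  have hmi : Integrable (fun ω => posteriorMean (P.map X) r (X ω + Z ω / r)) P :=
    (hXi.sub hdi).congr (ae_of_all _ fun ω => by simp)
  refine ae_eq_condExp_of_forall_setIntegral_eq hY.comap_le hXi
    (fun s _ _ => hmi.integrableOn) ?_ ?_
  · rintro _ ⟨s, hs, rfl⟩ -
    have hpre : MeasurableSet ((fun ω => r * X ω + Z ω) ⁻¹' s) := hY hs
    rw [eq_comm, ← sub_eq_zero, ← integral_sub hXi.integrableOn hmi.integrableOn,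
      ← integral_indicator hpre]
    let g : ℝ × ℝ → ℝ := fun p =>
      s.indicator (fun _ => (1 : ℝ)) (r * p.2) * (p.1 - posteriorMean (P.map X) r p.2)
    have hind : Measurable (s.indicator fun _ => (1 : ℝ)) := measurable_const.indicator hs
    have hg : Measurable g := by fun_prop
    have e : (((fun ω => r * X ω + Z ω) ⁻¹' s).indicator
        fun ω => X ω - posteriorMean (P.map X) r (X ω + Z ω / r)) =
        fun ω => g (X ω, X ω + Z ω / r) := by
      ext ω
      have h : r * (X ω + Z ω / r) = r * X ω + Z ω := by field_simp
      by_cases hω : r * X ω + Z ω ∈ s <;> simp [g, h, hω, Set.indicator]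
    have hgi : Integrable (fun ω => g (X ω, X ω + Z ω / r)) P := e ▸ hdi.indicator hpre
    rw [e, integral_channel hX hZ hindep hZlaw hr hg, integral_prod_symm _
      ((integrable_channel_iff hX hZ hindep hZlaw hr hg).1 hgi)]
    have h0 : ∀ t, ∫ x, gaussKer r (t - x) * g (x, t) ∂(P.map X) = 0 := fun t => by
      simp only [g]
      simp_rw [mul_left_comm (gaussKer r _)]
      rw [integral_const_mul, integral_gaussKer_mul_sub_posteriorMean _ hr, mul_zero]
    simp [h0]
  · have e : (fun ω => posteriorMean (P.map X) r (X ω + Z ω / r)) =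
        (fun y => posteriorMean (P.map X) r (y / r)) ∘ fun ω => r * X ω + Z ω := by
      ext ω
      simp only [Function.comp_apply]
      congr 1
      field_simp
    rw [e]
    exact ((hm.comp (measurable_id.div_const r)).comp
      (comap_measurable _)).stronglyMeasurable.aestronglyMeasurable

end Channel

/-- I-MMSE relation in the parameter `ρ = √snr`: for the channel `Y = ρ·X + Z` with
`Z ~ N(0,1)` independent of `X` and `E[X²] < ∞`, `d/dρ I(X;Y) = ρ·E[(X − E[X|Y])²]`. -/
theorem i_mmse_rho {Ω : Type*} [MeasurableSpace Ω] (P : Measure Ω)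
    [IsProbabilityMeasure P] (X Z : Ω → ℝ) (hX : Measurable X) (hZ : Measurable Z)
    (hindep : IndepFun X Z P) (hZlaw : P.map Z = gaussianReal 0 1)
    (hX2 : Integrable (fun ω => (X ω) ^ 2) P)
    (ρ : ℝ) (hρ : 0 < ρ) :
    HasDerivAt (fun r : ℝ => mutualInfo P X (fun ω => r * X ω + Z ω))
      (ρ * ∫ ω, (X ω -
          (P[X | MeasurableSpace.comap (fun ω => ρ * X ω + Z ω) inferInstance]) ω) ^ 2 ∂P)
      ρ := by
  have : IsProbabilityMeasure (P.map X) := Measure.isProbabilityMeasure_map hX.aemeasurable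
  have hderiv := ((hasDerivAt_mul_integral_gaussMoment_mul_log
    (integrable_map_sq hX hX2) hρ).const_mul (√(2 * π))⁻¹).const_sub (∫ ω, -(Z ω ^ 2) / 2 ∂P)
  have hmmse : ∫ ω, (X ω - (P[X | MeasurableSpace.comap (fun ω => ρ * X ω + Z ω)
      inferInstance]) ω) ^ 2 ∂P =
      ∫ ω, (X ω - posteriorMean (P.map X) ρ (X ω + Z ω / ρ)) ^ 2 ∂P := by
    refine integral_congr_ae ?_
    filter_upwards [posteriorMean_ae_eq_condExp hX hZ hindep hZlaw hX2 hρ] with ω hω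
    rw [hω]
  refine (hderiv.congr_of_eventuallyEq ?_).congr_deriv ?_
  · filter_upwards [lt_mem_nhds hρ] with r hr
    exact mutualInfo_channel hX hZ hindep hZlaw hX2 hr
  · rw [hmmse, integral_sub_posteriorMean_sq hX hZ hindep hZlaw hX2 hρ]
    ring
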